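/- Let T = {A ⊑ ◇_F B} and A = {A(a,0), C(a,1)}, and let q₁(x) = ∃t (C(x,t) ∧ B(x,t)) and q₂(x) = ∃t,t′ ((t < t′) ∧ C(x,t) ∧ B(x,t′)). Then (T,A) ⊨ q₁(a) ∨ q₂(a), but (T,A) ⊭ q₁(a) and (T,A) ⊭ q₂(a). -/

import Mathlib

namespace TQL

/-! ## Syntax of TQL -/

/-- Basic roles: ⊥, a role name `P`, or an inverse role `P⁻`. -/
inductive BRole
  | bot
  | name (p : ℕ)
  | inv (p : ℕ)
deriving DecidableEq

/-- The inverse `R⁻` of a basic role. -/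
def BRole.minus : BRole → BRole
  | .bot => .bot
  | .name p => .inv p
  | .inv p => .name p

/-- Basic concepts: ⊥, a concept name `A`, or `∃R`. -/
inductive BConcept
  | bot
  | name (a : ℕ)
  | ex (r : BRole)
deriving DecidableEq

/-- TQL concepts. -/
inductive Concept
  | basic (b : BConcept)
  | inter (c₁ c₂ : Concept)
  | diaP (c : Concept)
  | diaF (c : Concept)
deriving DecidableEq

/-- TQL roles. -/
inductive Role
  | basic (r : BRole)
  | inter (s₁ s₂ : Role)
  | diaP (s : Role)
  | diaF (s : Role)
deriving DecidableEq

/-- TBox inclusions: `C ⊑ B` (B basic concept) and `S ⊑ R` (R basic role). -/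
inductive Inclusion
  | ci (c : Concept) (b : BConcept)
  | ri (s : Role) (r : BRole)
deriving DecidableEq

/-- A TQL TBox: a finite set of inclusions. -/
abbrev TBox := Finset Inclusion

/-- ABox atoms `A(a,n)` and `P(a,b,n)`. -/
inductive ABoxAtom
  | conc (a : ℕ) (x : ℕ) (n : ℤ)
  | role (p : ℕ) (x y : ℕ) (n : ℤ)
deriving DecidableEq

/-- A TQL ABox: a finite set of atoms. -/
abbrev ABox := Finset ABoxAtom

def ABoxAtom.inds : ABoxAtom → Finset ℕ
  | .conc _ x _ => {x}
  | .role _ x y _ => {x, y}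

def ABoxAtom.tems : ABoxAtom → Finset ℤ
  | .conc _ _ n => {n}
  | .role _ _ _ n => {n}

/-- `ind(A)`: the individual constants occurring in the ABox. -/
def aboxInds (A : ABox) : Finset ℕ := A.biUnion ABoxAtom.inds

/-- `tem(A)`: the temporal constants occurring in the ABox. -/
def aboxTems (A : ABox) : Finset ℤ := A.biUnion ABoxAtom.tems

/-! ### Names occurring in concepts, roles, TBoxes -/

def BRole.rnames : BRole → Finset ℕ
  | .bot => ∅
  | .name p => {p}
  | .inv p => {p}

def BConcept.cnames : BConcept → Finset ℕ
  | .bot => ∅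
  | .name a => {a}
  | .ex _ => ∅

def BConcept.rnames : BConcept → Finset ℕ
  | .bot => ∅
  | .name _ => ∅
  | .ex r => r.rnames

def Concept.cnames : Concept → Finset ℕ
  | .basic b => b.cnames
  | .inter c₁ c₂ => c₁.cnames ∪ c₂.cnames
  | .diaP c => c.cnames
  | .diaF c => c.cnames

def Concept.rnames : Concept → Finset ℕ
  | .basic b => b.rnames
  | .inter c₁ c₂ => c₁.rnames ∪ c₂.rnames
  | .diaP c => c.rnames
  | .diaF c => c.rnames

def Role.rnames : Role → Finset ℕ
  | .basic r => r.rnames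
  | .inter s₁ s₂ => s₁.rnames ∪ s₂.rnames
  | .diaP s => s.rnames
  | .diaF s => s.rnames

def Inclusion.cnames : Inclusion → Finset ℕ
  | .ci c b => c.cnames ∪ b.cnames
  | .ri _ _ => ∅

def Inclusion.rnames : Inclusion → Finset ℕ
  | .ci c b => c.rnames ∪ b.rnames
  | .ri s r => s.rnames ∪ r.rnames

/-- Concept names occurring in a TBox. -/
def cnamesT (T : TBox) : Finset ℕ := T.biUnion Inclusion.cnames

/-- Role names occurring in a TBox. -/
def rnamesT (T : TBox) : Finset ℕ := T.biUnion Inclusion.rnames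

/-- `|T|`: the number of concept and role names in `T`. -/
def sizeT (T : TBox) : ℕ := (cnamesT T).card + (rnamesT T).card

/-- `role(T)`: the role names of `T` together with their inverses. -/
def roleT (T : TBox) : Finset BRole :=
  (rnamesT T).image BRole.name ∪ (rnamesT T).image BRole.inv

/-- `|role(T)|`. -/
def roleTCard (T : TBox) : ℕ := (roleT T).card

/-! ### Normal forms -/

/-- An inclusion is in normal form if it has one of the shapes
`B₁ ⊓ B₂ ⊑ B`, `◇_F B₁ ⊑ B₂`, `◇_P B₁ ⊑ B₂` (for concepts), and analogously for roles. -/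
def Inclusion.InNF : Inclusion → Prop
  | .ci c _ =>
      (∃ B₁ B₂, c = .inter (.basic B₁) (.basic B₂)) ∨
      (∃ B, c = .diaF (.basic B)) ∨ (∃ B, c = .diaP (.basic B))
  | .ri s _ =>
      (∃ R₁ R₂, s = .inter (.basic R₁) (.basic R₂)) ∨
      (∃ R, s = .diaF (.basic R)) ∨ (∃ R, s = .diaP (.basic R))

/-- A TBox is in normal form. -/
def InNF (T : TBox) : Prop := ∀ incl ∈ T, incl.InNF

/-- A TBox in normal form is flat if no inclusion has a concept `∃R` on its right-hand side. -/
def IsFlat (T : TBox) : Prop :=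
  InNF T ∧ ∀ (c : Concept) (R : BRole), Inclusion.ci c (.ex R) ∉ T

/-! ## Semantics -/

/-- A temporal interpretation over a domain `D`: for each `n : ℤ` a structure, with rigid
injective interpretation of individual constants. -/
structure Interp (D : Type) where
  constI : ℕ → D
  constInj : Function.Injective constI
  concI : ℕ → ℤ → Set D
  roleI : ℕ → ℤ → Set (D × D)

variable {D : Type}

def BRole.interp (I : Interp D) : BRole → ℤ → Set (D × D)
  | .bot, _ => ∅
  | .name p, n => I.roleI p n
  | .inv p, n => {xy | (xy.2, xy.1) ∈ I.roleI p n}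

def BConcept.interp (I : Interp D) : BConcept → ℤ → Set D
  | .bot, _ => ∅
  | .name a, n => I.concI a n
  | .ex r, n => {x | ∃ y, (x, y) ∈ BRole.interp I r n}

def Concept.interp (I : Interp D) : Concept → ℤ → Set D
  | .basic b, n => BConcept.interp I b n
  | .inter c₁ c₂, n => Concept.interp I c₁ n ∩ Concept.interp I c₂ n
  | .diaP c, n => {x | ∃ m, m < n ∧ x ∈ Concept.interp I c m}
  | .diaF c, n => {x | ∃ m, n < m ∧ x ∈ Concept.interp I c m}

def Role.interp (I : Interp D) : Role → ℤ → Set (D × D)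
  | .basic r, n => BRole.interp I r n
  | .inter s₁ s₂, n => Role.interp I s₁ n ∩ Role.interp I s₂ n
  | .diaP s, n => {xy | ∃ m, m < n ∧ xy ∈ Role.interp I s m}
  | .diaF s, n => {xy | ∃ m, n < m ∧ xy ∈ Role.interp I s m}

/-- Satisfaction of an inclusion (globally, at all time points). -/
def Inclusion.holds (I : Interp D) : Inclusion → Prop
  | .ci c b => ∀ n, Concept.interp I c n ⊆ BConcept.interp I b n
  | .ri s r => ∀ n, Role.interp I s n ⊆ BRole.interp I r n

def ABoxAtom.holds (I : Interp D) : ABoxAtom → Prop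
  | .conc a x n => I.constI x ∈ I.concI a n
  | .role p x y n => (I.constI x, I.constI y) ∈ I.roleI p n

/-- `I` satisfies all inclusions of `T`. -/
def SatisfiesTBox (I : Interp D) (T : TBox) : Prop := ∀ incl ∈ T, incl.holds I

/-- `I` is a model of the KB `(T, A)`. -/
def IsModel (I : Interp D) (T : TBox) (A : ABox) : Prop :=
  SatisfiesTBox I T ∧ ∀ α ∈ A, α.holds I

/-- The KB `(T, A)` is consistent: it has a model (over a nonempty domain). -/
def Consistent (T : TBox) (A : ABox) : Prop :=
  ∃ (D : Type) (_ : Nonempty D) (I : Interp D), IsModel I T A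

/-! ## Conjunctive queries -/

/-- Atoms of conjunctive queries; `Sum.inl` is a constant, `Sum.inr` a variable. -/
inductive QAtom (νI νT : Type)
  | conc (a : ℕ) (ξ : ℕ ⊕ νI) (τ : ℤ ⊕ νT)
  | role (p : ℕ) (ξ ζ : ℕ ⊕ νI) (τ : ℤ ⊕ νT)
  | eq (τ σ : ℤ ⊕ νT)
  | lt (τ σ : ℤ ⊕ νT)

/-- A conjunctive query `q(x⃗, s⃗)` with `nx` free individual variables, `ns` free
temporal variables, `ny` bound individual variables and `nt` bound temporal variables. -/
structure CQ (nx ns : ℕ) where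
  ny : ℕ
  nt : ℕ
  atoms : List (QAtom (Fin nx ⊕ Fin ny) (Fin ns ⊕ Fin nt))

/-- A union of conjunctive queries. -/
abbrev UCQ (nx ns : ℕ) := List (CQ nx ns)

def evalIT {ι νI : Type} (cI : ℕ → ι) (g : νI → ι) : ℕ ⊕ νI → ι
  | .inl c => cI c
  | .inr v => g v

def evalTT {νT : Type} (g : νT → ℤ) : ℤ ⊕ νT → ℤ
  | .inl n => n
  | .inr v => g v

/-- Satisfaction of a query atom in a temporal interpretation. -/
def QAtom.holdsI {νI νT} (I : Interp D) (gI : νI → D) (gT : νT → ℤ) : QAtom νI νT → Prop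
  | .conc a ξ τ => evalIT I.constI gI ξ ∈ I.concI a (evalTT gT τ)
  | .role p ξ ζ τ => (evalIT I.constI gI ξ, evalIT I.constI gI ζ) ∈ I.roleI p (evalTT gT τ)
  | .eq τ σ => evalTT gT τ = evalTT gT σ
  | .lt τ σ => evalTT gT τ < evalTT gT σ

/-- `I ⊨ q(a⃗, n⃗)`: bound individual variables range over the domain, bound temporal
variables over ℤ. -/
def CQ.holdsInterp {nx ns} (q : CQ nx ns) (I : Interp D)
    (av : Fin nx → ℕ) (nv : Fin ns → ℤ) : Prop :=
  ∃ (bv : Fin q.ny → D) (bt : Fin q.nt → ℤ),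
    ∀ α ∈ q.atoms, QAtom.holdsI I (Sum.elim (fun i => I.constI (av i)) bv) (Sum.elim nv bt) α

/-- `(T, A) ⊨ q(a⃗, n⃗)`: certain answers. -/
def CertainAnswer (T : TBox) (A : ABox) {nx ns} (q : CQ nx ns)
    (av : Fin nx → ℕ) (nv : Fin ns → ℤ) : Prop :=
  ∀ (D : Type), Nonempty D → ∀ I : Interp D, IsModel I T A → q.holdsInterp I av nv

/-! ### Evaluation over data instances -/

/-- A two-sorted data instance: individual and temporal domains and the relations given
by its atoms (including the explicit precedence relation `<`). -/
structure DataInst where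
  indDom : Set ℕ
  temDom : Set ℤ
  concAt : ℕ → ℕ → ℤ → Prop
  roleAt : ℕ → ℕ → ℕ → ℤ → Prop
  ltAt : ℤ → ℤ → Prop

def QAtom.holdsData {νI νT} (Dt : DataInst) (gI : νI → ℕ) (gT : νT → ℤ) :
    QAtom νI νT → Prop
  | .conc a ξ τ => Dt.concAt a (evalIT id gI ξ) (evalTT gT τ)
  | .role p ξ ζ τ => Dt.roleAt p (evalIT id gI ξ) (evalIT id gI ζ) (evalTT gT τ)
  | .eq τ σ => evalTT gT τ = evalTT gT σ
  | .lt τ σ => Dt.ltAt (evalTT gT τ) (evalTT gT σ)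

/-- Evaluation of a CQ over a data instance: quantified variables range over the
individual/temporal domains of the instance. -/
def CQ.holdsOn {nx ns} (q : CQ nx ns) (Dt : DataInst)
    (av : Fin nx → ℕ) (nv : Fin ns → ℤ) : Prop :=
  ∃ (bv : Fin q.ny → ℕ), (∀ i, bv i ∈ Dt.indDom) ∧
    ∃ (bt : Fin q.nt → ℤ), (∀ j, bt j ∈ Dt.temDom) ∧
      ∀ α ∈ q.atoms, QAtom.holdsData Dt (Sum.elim av bv) (Sum.elim nv bt) α

/-- Evaluation of a UCQ over a data instance. -/
def UCQ.holdsOn {nx ns} (Q : UCQ nx ns) (Dt : DataInst)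
    (av : Fin nx → ℕ) (nv : Fin ns → ℤ) : Prop :=
  ∃ q ∈ Q, CQ.holdsOn q Dt av nv

/-- The convex closure of `tem(A)` in ℤ. -/
def temHull (A : ABox) : Set ℤ :=
  {n | ∃ n₁ ∈ aboxTems A, ∃ n₂ ∈ aboxTems A, n₁ ≤ n ∧ n ≤ n₂}

/-- The data instance `[A]`: `A` together with the precedence relation on the convex
closure of its temporal constants. -/
def bracketData (A : ABox) : DataInst where
  indDom := ↑(aboxInds A)
  temDom := temHull A
  concAt := fun a x n => ABoxAtom.conc a x n ∈ A
  roleAt := fun p x y n => ABoxAtom.role p x y n ∈ A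
  ltAt := fun n₁ n₂ => n₁ < n₂ ∧ n₁ ∈ temHull A ∧ n₂ ∈ temHull A

/-- The data instance `A^ℤ`: `A` together with the full precedence relation on ℤ. -/
def intData (A : ABox) : DataInst where
  indDom := ↑(aboxInds A)
  temDom := Set.univ
  concAt := fun a x n => ABoxAtom.conc a x n ∈ A
  roleAt := fun p x y n => ABoxAtom.role p x y n ∈ A
  ltAt := fun n₁ n₂ => n₁ < n₂

/-! ### Temporal constants of queries -/

def tcOf {νT : Type} : ℤ ⊕ νT → Finset ℤ
  | .inl n => {n}
  | .inr _ => ∅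

def QAtom.temConsts {νI νT} : QAtom νI νT → Finset ℤ
  | .conc _ _ τ => tcOf τ
  | .role _ _ _ τ => tcOf τ
  | .eq τ σ => tcOf τ ∪ tcOf σ
  | .lt τ σ => tcOf τ ∪ tcOf σ

def CQ.temConsts {nx ns} (q : CQ nx ns) : Finset ℤ :=
  (q.atoms.map QAtom.temConsts).foldr (· ∪ ·) ∅

def UCQ.temConsts {nx ns} (Q : UCQ nx ns) : Finset ℤ :=
  (Q.map CQ.temConsts).foldr (· ∪ ·) ∅

/-! ## The closure operators and canonical models -/

/-- Atoms used in the closure construction: `B(u,n)` for a basic concept `B`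
(covering `A(u,n)`, `∃R(u,n)` and `⊥(u,n)`), `R(u,v,n)` for a basic role and `(n < m)`. -/
inductive CAtom (ι : Type)
  | conc (B : BConcept) (u : ι) (n : ℤ)
  | rl (R : BRole) (u v : ι) (n : ℤ)
  | lt (n m : ℤ)

def CAtom.mentionsTime {ι} : CAtom ι → ℤ → Prop
  | .conc _ _ n, k => n = k
  | .rl _ _ _ n, k => n = k
  | .lt n m, k => n = k ∨ m = k

/-- A time point occurs in a set of atoms. -/
def timeOccurs {ι} (S : Set (CAtom ι)) (n : ℤ) : Prop := ∃ α ∈ S, CAtom.mentionsTime α n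

def CAtom.indsOf {ι} : CAtom ι → Set ι
  | .conc _ u _ => {u}
  | .rl _ u v _ => {u, v}
  | .lt _ _ => ∅

/-- The individual names occurring in a set of atoms. -/
def domOf {ι} (S : Set (CAtom ι)) : Set ι := {u | ∃ α ∈ S, u ∈ CAtom.indsOf α}

/-- `⊥` occurs in the set of atoms. -/
def hasBot {ι} (S : Set (CAtom ι)) : Prop :=
  (∃ u n, CAtom.conc .bot u n ∈ S) ∨ (∃ u v n, CAtom.rl .bot u v n ∈ S)

/-- One-step derivability by the rules (ex), (c1)–(c3), (r1)–(r3). -/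
inductive Deriv {ι} (T : TBox) (S : Set (CAtom ι)) : CAtom ι → Prop
  | ex₁ {R u v n} : CAtom.rl R u v n ∈ S → Deriv T S (.conc (.ex R) u n)
  | ex₂ {R u v n} : CAtom.rl R u v n ∈ S → Deriv T S (.conc (.ex R.minus) v n)
  | c1 {B₁ B₂ B u n} :
      Inclusion.ci (.inter (.basic B₁) (.basic B₂)) B ∈ T →
      CAtom.conc B₁ u n ∈ S → CAtom.conc B₂ u n ∈ S → Deriv T S (.conc B u n)
  | c2 {B B' u m n} :
      Inclusion.ci (.diaP (.basic B)) B' ∈ T →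
      CAtom.conc B u m ∈ S → m < n → timeOccurs S n → Deriv T S (.conc B' u n)
  | c3 {B B' u m n} :
      Inclusion.ci (.diaF (.basic B)) B' ∈ T →
      CAtom.conc B u m ∈ S → n < m → timeOccurs S n → Deriv T S (.conc B' u n)
  | r1 {R₁ R₂ R u v n} :
      Inclusion.ri (.inter (.basic R₁) (.basic R₂)) R ∈ T →
      CAtom.rl R₁ u v n ∈ S → CAtom.rl R₂ u v n ∈ S → Deriv T S (.rl R u v n)
  | r2 {R R' u v m n} :
      Inclusion.ri (.diaP (.basic R)) R' ∈ T →
      CAtom.rl R u v m ∈ S → m < n → timeOccurs S n → Deriv T S (.rl R' u v n)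
  | r3 {R R' u v m n} :
      Inclusion.ri (.diaF (.basic R)) R' ∈ T →
      CAtom.rl R u v m ∈ S → n < m → timeOccurs S n → Deriv T S (.rl R' u v n)

/-- The operator `cl`: one simultaneous (non-recursive) application of the rules. -/
def cl {ι} (T : TBox) (S : Set (CAtom ι)) : Set (CAtom ι) := S ∪ {α | Deriv T S α}

/-- `cl^∞`. -/
def clInf {ι} (T : TBox) (S : Set (CAtom ι)) : Set (CAtom ι) := ⋃ i, (cl T)^[i] S

/-! ### Tree individuals and the rule (⇝) -/

/-- Individuals of canonical models: an ABox individual constant together with a path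
of (time-offset, role) pairs recording applications of the rule (⇝);
`(a, [])` is the ABox individual `a` itself. -/
abbrev TreeInd := ℕ × List (ℤ × BRole)

/-- The absolute time at which the individual was created (sum of offsets). -/
def absOf (u : TreeInd) : ℤ := (u.2.map Prod.fst).sum

/-- The depth of a tree individual. -/
def depthOf (u : TreeInd) : ℕ := u.2.length

/-- The canonical fresh individual created by applying (⇝) to `u` at time `n` for `R`. -/
def succInd (u : TreeInd) (n : ℤ) (R : BRole) : TreeInd := (u.1, u.2 ++ [(n - absOf u, R)])

/-- The operator `cl₁`: `cl` together with the rule (⇝). -/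
def cl1 (T : TBox) (S : Set (CAtom TreeInd)) : Set (CAtom TreeInd) :=
  cl T S ∪ {α | ∃ R u n, α = CAtom.rl R u (succInd u n R) n ∧
      CAtom.conc (.ex R) u n ∈ S ∧ ∀ v, CAtom.rl R u v n ∉ S}

/-- `cl₁^∞`. -/
def cl1Inf (T : TBox) (S : Set (CAtom TreeInd)) : Set (CAtom TreeInd) := ⋃ i, (cl1 T)^[i] S

/-- `u ⇝ⁿ_R v` in the construction starting from `S`. -/
def LeadsTo (T : TBox) (S : Set (CAtom TreeInd)) (u : TreeInd) (n : ℤ) (R : BRole)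
    (v : TreeInd) : Prop :=
  v = succInd u n R ∧
    ∃ i, CAtom.conc (.ex R) u n ∈ (cl1 T)^[i] S ∧ ∀ w, CAtom.rl R u w n ∉ (cl1 T)^[i] S

/-- All atoms `(n < m)` with `n < m` in ℤ. -/
def ltAtoms {ι : Type} : Set (CAtom ι) := {α | ∃ n m : ℤ, n < m ∧ α = CAtom.lt n m}

def ABoxAtom.toC : ABoxAtom → CAtom ℕ
  | .conc a x n => .conc (.name a) x n
  | .role p x y n => .rl (.name p) x y n

def ABoxAtom.toCT : ABoxAtom → CAtom TreeInd
  | .conc a x n => .conc (.name a) (x, []) n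
  | .role p x y n => .rl (.name p) (x, []) (y, []) n

/-- The atoms of `A^ℤ` (over ABox individuals). -/
def initAtoms (A : ABox) : Set (CAtom ℕ) := (ABoxAtom.toC '' ↑A) ∪ ltAtoms

/-- The atoms of `A^ℤ` (over tree individuals). -/
def initAtomsT (A : ABox) : Set (CAtom TreeInd) := (ABoxAtom.toCT '' ↑A) ∪ ltAtoms

/-- The canonical model of a KB with a flat TBox, as a set of atoms over `ind(A)`. -/
def CKflat (T : TBox) (A : ABox) : Set (CAtom ℕ) := clInf T (initAtoms A)

/-- The canonical model `C_K` of a KB, identified with the set of atoms `cl₁^∞(A^ℤ)`. -/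
def CK (T : TBox) (A : ABox) : Set (CAtom TreeInd) := cl1Inf T (initAtomsT A)

/-! ### Evaluating CQs in canonical models (as sets of atoms) -/

def QAtom.holdsC {ι νI νT} (S : Set (CAtom ι)) (cI : ℕ → ι) (gI : νI → ι) (gT : νT → ℤ) :
    QAtom νI νT → Prop
  | .conc a ξ τ => CAtom.conc (.name a) (evalIT cI gI ξ) (evalTT gT τ) ∈ S
  | .role p ξ ζ τ =>
      CAtom.rl (.name p) (evalIT cI gI ξ) (evalIT cI gI ζ) (evalTT gT τ) ∈ S
  | .eq τ σ => evalTT gT τ = evalTT gT σ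
  | .lt τ σ => evalTT gT τ < evalTT gT σ

/-- Satisfaction of a CQ in a canonical model given as a set of atoms, with quantified
individual variables ranging over `dom` and temporal variables over ℤ. -/
def CQ.holdsC {nx ns ι} (q : CQ nx ns) (S : Set (CAtom ι)) (dom : Set ι) (cI : ℕ → ι)
    (av : Fin nx → ℕ) (nv : Fin ns → ℤ) : Prop :=
  ∃ (bv : Fin q.ny → ι), (∀ i, bv i ∈ dom) ∧ ∃ (bt : Fin q.nt → ℤ),
    ∀ α ∈ q.atoms, QAtom.holdsC S cI (Sum.elim (fun i => cI (av i)) bv) (Sum.elim nv bt) α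

/-! ### `K_{T,R}` and concept normal form -/

/-- The TBox of `K_{T,R}`: `T ∪ {A_g ⊑ ∃R}` where `g` is (the index of) a fresh
concept name. -/
def KTRT (T : TBox) (g : ℕ) (R : BRole) : TBox :=
  insert (.ci (.basic (.name g)) (.ex R)) T

/-- The ABox of `K_{T,R}`: `{A_g(a, 0)}`. -/
def KTRA (g a : ℕ) : ABox := {ABoxAtom.conc g a 0}

/-- The canonical model of `K_{T,R}` (as a set of atoms). -/
def CKTR (T : TBox) (g a : ℕ) (R : BRole) : Set (CAtom TreeInd) :=
  CK (KTRT T g R) (KTRA g a)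

/-- `T` is in concept normal form (CoNF). -/
def IsCoNF (T : TBox) : Prop :=
  InNF T ∧ ∀ R ∈ roleT T, ∃ Af : ℤ → ℕ,
    Inclusion.ci (.basic (.ex R)) (.name (Af 0)) ∈ T ∧
    Inclusion.ci (.diaF (.basic (.ex R))) (.name (Af (-1))) ∈ T ∧
    (∀ m : ℕ, m ≤ roleTCard T →
      Inclusion.ci (.diaF (.basic (.name (Af (-(m : ℤ)))))) (.name (Af (-(m : ℤ) - 1))) ∈ T) ∧
    Inclusion.ci (.diaP (.basic (.ex R))) (.name (Af 1)) ∈ T ∧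
    (∀ m : ℕ, m ≤ roleTCard T →
      Inclusion.ci (.diaP (.basic (.name (Af (m : ℤ))))) (.name (Af ((m : ℤ) + 1))) ∈ T) ∧
    (∀ m : ℤ, |m| ≤ (roleTCard T : ℤ) → ∀ R' : BRole, ∀ g a : ℕ, g ∉ cnamesT T →
      CAtom.rl R' (a, ([] : List (ℤ × BRole))) (succInd (a, []) 0 R) m ∈ CKTR T g a R →
      Inclusion.ci (.basic (.name (Af m))) (.ex R') ∈ T)

/-! ### Restrictions of canonical models -/

/-- `C_K^d`: restriction to individuals of depth at most `d`. -/
def CKd (T : TBox) (A : ABox) (d : ℕ) : Set (CAtom TreeInd) :=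
  {α | α ∈ CK T A ∧ ∀ u ∈ CAtom.indsOf α, depthOf u ≤ d}

/-- `n` lies in `[min tem(A) − ℓ, max tem(A) + ℓ]`. -/
def inWindow (A : ABox) (ℓ : ℕ) (n : ℤ) : Prop :=
  ∃ n₁ ∈ aboxTems A, ∃ n₂ ∈ aboxTems A, n₁ - ℓ ≤ n ∧ n ≤ n₂ + ℓ

/-- `C_K^{d,ℓ}`: further restriction to time points in the window. -/
def CKdl (T : TBox) (A : ABox) (d ℓ : ℕ) : Set (CAtom TreeInd) :=
  {α | α ∈ CKd T A d ∧ ∀ n, CAtom.mentionsTime α n → inWindow A ℓ n}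


/-! Concept names: `A = 0`, `C = 1`, `B = 2`; the individual constant `a = 0`.
The TBox is the single (non-TQL) inclusion `A ⊑ ◇_F B`, interpreted directly. -/

/-- `I` satisfies the inclusion `A ⊑ ◇_F B` (globally). -/
def SatAsubDiaFB {D : Type} (I : Interp D) : Prop :=
  ∀ n : ℤ, ∀ x ∈ I.concI 0 n, ∃ m : ℤ, n < m ∧ x ∈ I.concI 2 m

/-- `I` satisfies the ABox `{A(a,0), C(a,1)}`. -/
def SatABox19 {D : Type} (I : Interp D) : Prop :=
  I.constI 0 ∈ I.concI 0 0 ∧ I.constI 0 ∈ I.concI 1 1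

/-- `I ⊨ q₁(a)`, where `q₁(x) = ∃t (C(x,t) ∧ B(x,t))`. -/
def Q1holds {D : Type} (I : Interp D) : Prop :=
  ∃ t : ℤ, I.constI 0 ∈ I.concI 1 t ∧ I.constI 0 ∈ I.concI 2 t

/-- `I ⊨ q₂(a)`, where `q₂(x) = ∃t,t′ ((t < t′) ∧ C(x,t) ∧ B(x,t′))`. -/
def Q2holds {D : Type} (I : Interp D) : Prop :=
  ∃ t t' : ℤ, t < t' ∧ I.constI 0 ∈ I.concI 1 t ∧ I.constI 0 ∈ I.concI 2 t'

/-- The interpretation over `ℕ` in which every element is in `A` exactly at time `0`, in `C`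
exactly at time `1`, and in `B` exactly at time `b`. -/
def witnessInterp (b : ℤ) : Interp ℕ where
  constI := id
  constInj := Function.injective_id
  concI k t := {_x | k = 0 ∧ t = 0 ∨ k = 1 ∧ t = 1 ∨ k = 2 ∧ t = b}
  roleI _ _ := ∅

theorem satAsubDiaFB_witnessInterp {b : ℤ} (hb : 0 < b) : SatAsubDiaFB (witnessInterp b) := by
  intro n x hx
  have hn : n = 0 := by simpa [witnessInterp] using hx
  exact ⟨b, hn ▸ hb, by simp [witnessInterp]⟩

theorem satABox19_witnessInterp (b : ℤ) : SatABox19 (witnessInterp b) := by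
  simp [SatABox19, witnessInterp]

theorem q1holds_witnessInterp_iff {b : ℤ} : Q1holds (witnessInterp b) ↔ b = 1 := by
  simp [Q1holds, witnessInterp, eq_comm]

theorem q2holds_witnessInterp_iff {b : ℤ} : Q2holds (witnessInterp b) ↔ 1 < b := by
  simp [Q2holds, witnessInterp]

/-- Section 6: certain answers to UCQs need not come from a single
disjunct. For `T = {A ⊑ ◇_F B}` and `A = {A(a,0), C(a,1)}`:
`(T,A) ⊨ q₁(a) ∨ q₂(a)`, but `(T,A) ⊭ q₁(a)` and `(T,A) ⊭ q₂(a)`. -/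
theorem disjunction_certain_but_no_disjunct :
    (∀ (D : Type), Nonempty D → ∀ I : Interp D,
      SatAsubDiaFB I → SatABox19 I → Q1holds I ∨ Q2holds I) ∧
    ¬ (∀ (D : Type), Nonempty D → ∀ I : Interp D,
      SatAsubDiaFB I → SatABox19 I → Q1holds I) ∧
    ¬ (∀ (D : Type), Nonempty D → ∀ I : Interp D,
      SatAsubDiaFB I → SatABox19 I → Q2holds I) := by
  refine ⟨fun D _ I hT hA => ?_, fun h => ?_, fun h => ?_⟩
  · obtain ⟨m, hm, hB⟩ := hT 0 _ hA.1
    rcases (Int.add_one_le_of_lt hm).eq_or_lt with rfl | hlt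
    · exact Or.inl ⟨1, hA.2, hB⟩
    · exact Or.inr ⟨1, m, hlt, hA.2, hB⟩
  · have := q1holds_witnessInterp_iff.mp
      (h ℕ ⟨0⟩ _ (satAsubDiaFB_witnessInterp two_pos) (satABox19_witnessInterp 2))
    omega
  · have := q2holds_witnessInterp_iff.mp
      (h ℕ ⟨0⟩ _ (satAsubDiaFB_witnessInterp one_pos) (satABox19_witnessInterp 1))
    omega

end TQL
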